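/- Fix q ∈ ℝ with 0 < q < 1/2, an integer H ≥ 1, and D ∈ ℝ. Let a(Δ) := (Q(q)^Δ)_{1,0} and λ(H,D) := (a(H) − (a(H)+q)D)/(a(H)+Hq). Then λ(H,D) ≥ λ(H+1,D) if and only if D ≤ W(H+1), where W(H+1) := ((H+1)(a(H)−a(H+1)) + a(H+1)) / (H(a(H)−a(H+1)) + a(H+1) + q). In particular, the time-average rewards of the threshold policies with thresholds H and H+1 are equal, λ(H,D) = λ(H+1,D), precisely when D equals the Whittle index W(H+1). -/

import Mathlib

open Matrix

/-- The one-step transition matrix of a symmetric two-state Markov chain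
with switching probability `q`. -/
def Qmat (q : ℝ) : Matrix (Fin 2) (Fin 2) ℝ := !![1 - q, q; q, 1 - q]

/-- `a q Δ` is the `(1,0)` entry of the `Δ`-th power of `Qmat q`. -/
def a (q : ℝ) (Δ : ℕ) : ℝ := (Qmat q ^ Δ) 1 0

/-- Time-average reward of the threshold policy with threshold `H`
under effective transmission cost `D`. -/
noncomputable def lam (q : ℝ) (H : ℕ) (D : ℝ) : ℝ :=
  (a q H - (a q H + q) * D) / (a q H + H * q)

theorem Qmat_pow_row_one (q : ℝ) (n : ℕ) :
    (Qmat q ^ n) 1 0 = (1 - (1 - 2 * q) ^ n) / 2 ∧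
    (Qmat q ^ n) 1 1 = (1 + (1 - 2 * q) ^ n) / 2 := by
  induction n with
  | zero => simp
  | succ n ih =>
    obtain ⟨h0, h1⟩ := ih
    rw [pow_succ, Matrix.mul_apply, Matrix.mul_apply, Fin.sum_univ_two, Fin.sum_univ_two, h0, h1]
    simp only [Qmat, Matrix.of_apply, Matrix.cons_val', Matrix.cons_val_zero, Matrix.cons_val_one,
      Matrix.cons_val_fin_one]
    constructor <;> ring

theorem a_eq (q : ℝ) (n : ℕ) : a q n = (1 - (1 - 2 * q) ^ n) / 2 :=
  (Qmat_pow_row_one q n).1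

theorem a_succ (q : ℝ) (n : ℕ) : a q (n + 1) = a q n + q * (1 - 2 * q) ^ n := by
  rw [a_eq, a_eq]
  ring

theorem natCast_mul_pow_le_a {q : ℝ} (hq0 : 0 ≤ q) (hq1 : q ≤ 1 / 2) (n : ℕ) :
    n * (q * (1 - 2 * q) ^ n) ≤ a q n := by
  induction n with
  | zero => simp [a_eq]
  | succ n ih =>
    have hpow : (1 - 2 * q) ^ (n + 1) ≤ (1 - 2 * q) ^ n :=
      pow_le_pow_of_le_one (by linarith) (by linarith) n.le_succ
    calc ((n + 1 : ℕ) : ℝ) * (q * (1 - 2 * q) ^ (n + 1))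
        ≤ ((n + 1 : ℕ) : ℝ) * (q * (1 - 2 * q) ^ n) := by gcongr
      _ = n * (q * (1 - 2 * q) ^ n) + q * (1 - 2 * q) ^ n := by push_cast; ring
      _ ≤ a q (n + 1) := by rw [a_succ]; gcongr

theorem a_nonneg {q : ℝ} (hq0 : 0 ≤ q) (hq1 : q ≤ 1 / 2) (n : ℕ) : 0 ≤ a q n := by
  have hr : 0 ≤ 1 - 2 * q := by linarith
  exact le_trans (by positivity) (natCast_mul_pow_le_a hq0 hq1 n)

theorem whittle_denom_pos {q : ℝ} (hq0 : 0 < q) (hq1 : q ≤ 1 / 2) (H : ℕ) :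
    0 < (H : ℝ) * (a q H - a q (H + 1)) + a q (H + 1) + q := by
  have hr : 0 ≤ q * (1 - 2 * q) ^ H := mul_nonneg hq0.le (pow_nonneg (by linarith) _)
  have h := natCast_mul_pow_le_a hq0.le hq1 H
  rw [a_succ]
  linarith

theorem lam_denom_pos {q : ℝ} (hq0 : 0 < q) (hq1 : q ≤ 1 / 2) {H : ℕ} (hH : 1 ≤ H) :
    0 < a q H + H * q :=
  add_pos_of_nonneg_of_pos (a_nonneg hq0.le hq1 H) (mul_pos (by exact_mod_cast hH) hq0)

/-- The numerator of `lam q H D - lam q (H + 1) D` after clearing denominators. -/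
theorem lam_cross_sub (q : ℝ) (H : ℕ) (D : ℝ) :
    (a q H - (a q H + q) * D) * (a q (H + 1) + (H + 1 : ℕ) * q) -
        (a q (H + 1) - (a q (H + 1) + q) * D) * (a q H + H * q) =
      q * ((((H : ℝ) + 1) * (a q H - a q (H + 1)) + a q (H + 1)) -
        D * ((H : ℝ) * (a q H - a q (H + 1)) + a q (H + 1) + q)) := by
  push_cast
  ring

theorem stmt_15 (q : ℝ) (hq0 : 0 < q) (hq1 : q < 1/2) (H : ℕ) (hH : 1 ≤ H) (D : ℝ)
    (Wsucc : ℝ)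
    (hW : Wsucc = (((H : ℝ) + 1) * (a q H - a q (H + 1)) + a q (H + 1)) /
      ((H : ℝ) * (a q H - a q (H + 1)) + a q (H + 1) + q)) :
    (lam q H D ≥ lam q (H + 1) D ↔ D ≤ Wsucc) ∧
    (lam q H D = lam q (H + 1) D ↔ D = Wsucc) := by
  have hden := whittle_denom_pos hq0 hq1.le H
  have h₁ := lam_denom_pos hq0 hq1.le hH
  have h₂ := lam_denom_pos hq0 hq1.le (Nat.le_add_left 1 H)
  have key := lam_cross_sub q H D
  subst hW
  constructor
  · rw [ge_iff_le, lam, lam, div_le_div_iff₀ h₂ h₁, le_div_iff₀ hden, ← sub_nonneg, key,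
      mul_nonneg_iff_of_pos_left hq0, sub_nonneg]
  · rw [lam, lam, div_eq_div_iff h₁.ne' h₂.ne', eq_div_iff hden.ne', ← sub_eq_zero, key,
      mul_eq_zero, or_iff_right hq0.ne', sub_eq_zero, eq_comm]
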